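/- arXiv:2310.16344 — 2 statements merged into one kernel-verified Lean document; each statement's English description precedes it below -/
import Mathlib

section
/- (Lemma 4 / final bipartite lemma.) For all integers r, q ≥ 1, let a = (2r)^{r+2q} and b = (2r)^{r+2q+2}. Let Π = (X, Σ, Φ) be a 2CSP instance with |X| sufficiently large. Let u be an r-sized multi-assignment on the a-subsets of X (each u(S) a nonempty set of at most r partial satisfying assignments on S) and v a q-sized multi-assignment on the b-subsets. Suppose u, v list-satisfy all bipartite consistency constraints: for every a-subset S and b-subset T, some σ_S ∈ u(S) and σ_T ∈ v(T) agree on S ∩ T. Then Π has a globally satisfying assignment. -/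
/-- A 2CSP instance: variables `X`, value universe `V`, per-variable domains,
and binary constraints on pairs of distinct variables. -/
structure CSP (X V : Type) where
  dom : X → Set V
  cons : Set ((X × X) × Set (V × V))
  distinct : ∀ c ∈ cons, c.1.1 ≠ c.1.2

/-- An assignment satisfies the instance. -/
def CSP.Satisfies {X V : Type} (P : CSP X V) (σ : X → V) : Prop :=
  (∀ x, σ x ∈ P.dom x) ∧ ∀ c ∈ P.cons, (σ c.1.1, σ c.1.2) ∈ c.2

/-- A partial assignment (represented as a total function whose values only
matter on `S`) satisfies all constraints induced within `S`. -/
def CSP.PartialSat {X V : Type} (P : CSP X V) (S : Finset X) (σ : X → V) : Prop :=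
  (∀ x ∈ S, σ x ∈ P.dom x) ∧
  ∀ c ∈ P.cons, c.1.1 ∈ S → c.1.2 ∈ S → (σ c.1.1, σ c.1.2) ∈ c.2

/-- `ρ` restricted to `F` can be prolonged within `R` to any `k` further points. -/
def Prolongs {X V : Type} [DecidableEq X] (R : Finset X → (X → V) → Prop) (k : ℕ)
    (F : Finset X) (ρ : X → V) : Prop :=
  ∀ K : Finset X, K.card ≤ k → ∃ ρ', R (F ∪ K) ρ' ∧ ∀ x ∈ F, ρ' x = ρ x

section LocalToGlobal

variable {X V : Type} [DecidableEq X] {R : Finset X → (X → V) → Prop}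

lemma Prolongs.anti (hR : ∀ F F' ρ, F ⊆ F' → R F' ρ → R F ρ) {k : ℕ} {F F' : Finset X}
    {ρ : X → V} (hF : F ⊆ F') (h : Prolongs R k F' ρ) : Prolongs R k F ρ := by
  intro K hK
  obtain ⟨ρ', h1, h2⟩ := h K hK
  exact ⟨ρ', hR _ _ _ (Finset.union_subset_union_left hF) h1, fun x hx => h2 x (hF hx)⟩

lemma Prolongs.self (hR : ∀ F F' ρ, F ⊆ F' → R F' ρ → R F ρ)
    (hcongr : ∀ F ρ ρ', (∀ x ∈ F, ρ x = ρ' x) → R F ρ → R F ρ') {k : ℕ} {F : Finset X}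
    {ρ : X → V} (h : Prolongs R k F ρ) : R F ρ := by
  obtain ⟨ρ', h1, h2⟩ := h ∅ (by simp)
  exact hcongr _ _ _ h2 (hR _ _ _ Finset.subset_union_left h1)

lemma Prolongs.exists_extension
    (hR : ∀ F F' ρ, F ⊆ F' → R F' ρ → R F ρ) {r : ℕ}
    (hcard : ∀ F : Finset X, (F.restrict '' {ρ : X → V | R F ρ}).encard ≤ r)
    {k k' : ℕ} {F K : Finset X} {ρ : X → V} (hk : K.card + r * k ≤ k')
    (h : Prolongs R k' F ρ) :
    ∃ ρ', Prolongs R k (F ∪ K) ρ' ∧ ∀ x ∈ F, ρ' x = ρ x := by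
  classical
  by_contra! hno
  have hfin : (((F ∪ K).restrict) '' {ρ : X → V | R (F ∪ K) ρ}).Finite :=
    Set.finite_of_encard_le_coe (hcard (F ∪ K))
  have hkill : ∀ p : ((F ∪ K : Finset X) → V), ∃ D : Finset X, D.card ≤ k ∧
      ∀ ρ', (F ∪ K).restrict ρ' = p → (∀ x ∈ F, ρ' x = ρ x) → ¬ R (F ∪ K ∪ D) ρ' := by
    intro p
    by_contra! hp
    obtain ⟨ρ₀, h0, h1, -⟩ := hp ∅ (by simp)
    have hP : Prolongs R k (F ∪ K) ρ₀ := by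
      intro D hD
      obtain ⟨ρ', h2, -, h4⟩ := hp D hD
      refine ⟨ρ', h4, fun x hx => ?_⟩
      exact congrFun (h2.trans h0.symm) ⟨x, hx⟩
    obtain ⟨x, hx, hne⟩ := hno ρ₀ hP
    exact hne (h1 x hx)
  choose D hDk hD using hkill
  have hcard' : hfin.toFinset.card ≤ r := by
    have := hcard (F ∪ K)
    rw [hfin.encard_eq_coe_toFinset_card] at this
    exact_mod_cast this
  have hbi : (hfin.toFinset.biUnion D).card ≤ r * k :=
    (Finset.card_biUnion_le_card_mul _ _ k fun p _ => hDk p).trans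
      (Nat.mul_le_mul_right k hcard')
  obtain ⟨ρ', h1, h2⟩ := h (K ∪ hfin.toFinset.biUnion D)
    ((Finset.card_union_le _ _).trans (by omega))
  rw [← Finset.union_assoc] at h1
  have hmem : (F ∪ K).restrict ρ' ∈ hfin.toFinset := by
    rw [Set.Finite.mem_toFinset]
    exact ⟨ρ', hR _ _ _ Finset.subset_union_left h1, rfl⟩
  refine hD _ ρ' rfl h2 (hR _ _ _ (Finset.union_subset_union_right ?_) h1)
  exact Finset.subset_biUnion_of_mem D hmem

lemma exists_global_of_prolongs
    (hR : ∀ F F' ρ, F ⊆ F' → R F' ρ → R F ρ)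
    (hcongr : ∀ F ρ ρ', (∀ x ∈ F, ρ x = ρ' x) → R F ρ → R F ρ') {r : ℕ}
    (hcard : ∀ F : Finset X, (F.restrict '' {ρ : X → V | R F ρ}).encard ≤ r)
    (k : ℕ → ℕ) (hk : ∀ n, 2 + r * k n ≤ k (n + 1)) (n : ℕ) :
    ∀ (ι : Type) [Fintype ι] [Nonempty ι], Fintype.card ι + n = r + 1 →
      ∀ (F : Finset X) (g : ι → X → V), (∀ i, Prolongs R (k n) F (g i)) →
      (Function.Injective fun i => F.restrict (g i)) →
      ∃ σ : X → V, ∀ x y, R {x, y} σ := by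
  classical
  induction n with
  | zero =>
    intro ι _ _ hι F g hg hinj
    exfalso
    have hsub : Set.range (fun i => F.restrict (g i)) ⊆ F.restrict '' {ρ : X → V | R F ρ} := by
      rintro _ ⟨i, rfl⟩
      exact ⟨g i, (hg i).self hR hcongr, rfl⟩
    have hle := (Set.encard_le_encard hsub).trans (hcard F)
    rw [← Set.image_univ, hinj.encard_image, Set.encard_univ, ENat.card_eq_coe_fintype_card] at hle
    have : Fintype.card ι ≤ r := by exact_mod_cast hle
    omega
  | succ n ih =>
    intro ι _ _ hι F g hg hinj
    have hext : ∀ K : Finset X, K.card ≤ 2 → ∀ i, ∃ ρ', Prolongs R (k n) (F ∪ K) ρ' ∧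
        ∀ x ∈ F, ρ' x = g i x := fun K hK i =>
      (hg i).exists_extension hR hcard (by have := hk n; omega)
    by_cases hsplit : ∃ (K : Finset X) (i : ι) (ρ₁ ρ₂ : X → V), K.card ≤ 2 ∧
        Prolongs R (k n) (F ∪ K) ρ₁ ∧ (∀ x ∈ F, ρ₁ x = g i x) ∧
        Prolongs R (k n) (F ∪ K) ρ₂ ∧ (∀ x ∈ F, ρ₂ x = g i x) ∧
        (F ∪ K).restrict ρ₁ ≠ (F ∪ K).restrict ρ₂
    · obtain ⟨K, i₀, ρ₁, ρ₂, hK, hP₁, hg₁, hP₂, hg₂, hne⟩ := hsplit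
      choose e heP heg using hext K hK
      have hgP : ∀ i, Prolongs R (k n) (F ∪ K) (Function.update e i₀ ρ₁ i) ∧
          ∀ x ∈ F, Function.update e i₀ ρ₁ i x = g i x := by
        intro i
        rcases eq_or_ne i i₀ with rfl | hi
        · simpa using ⟨hP₁, hg₁⟩
        · simpa [Function.update_of_ne hi] using ⟨heP i, heg i⟩
      have hinj' : ∀ i ρ j ρ', (∀ x ∈ F, ρ x = g i x) → (∀ x ∈ F, ρ' x = g j x) →
          (F ∪ K).restrict ρ = (F ∪ K).restrict ρ' → i = j := by
        intro i ρ j ρ' h1 h2 h3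
        apply hinj
        funext x
        have := congrFun h3 ⟨x, Finset.mem_union_left K x.2⟩
        simp only [Finset.restrict] at this ⊢
        rw [← h1 x x.2, ← h2 x x.2, this]
      refine ih (Option ι) (by simp; omega) (F ∪ K)
        (fun o => o.elim ρ₂ (Function.update e i₀ ρ₁)) ?_ ?_
      · rintro (_ | i)
        · exact hP₂
        · exact (hgP i).1
      · rintro (_ | i) (_ | j) hij
        · rfl
        · have := hinj' _ _ _ _ hg₂ (hgP j).2 hij
          subst this
          exact absurd (by simpa using hij.symm) hne
        · have := hinj' _ _ _ _ (hgP i).2 hg₂ hij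
          subst this
          exact absurd (by simpa using hij) hne
        · exact congrArg some (hinj' _ _ _ _ (hgP i).2 (hgP j).2 hij)
    · push Not at hsplit
      obtain ⟨i⟩ := ‹Nonempty ι›
      choose e heP heg using fun x : X => hext {x} (by simp) i
      refine ⟨fun x => e x x, fun x y => ?_⟩
      obtain ⟨ρ, hρ, hρg⟩ := hext {x, y} Finset.card_le_two i
      have hval : ∀ z ∈ ({x, y} : Finset X), ρ z = e z z := by
        intro z hz
        have := hsplit {z} i ρ (e z) (by simp)
          (hρ.anti hR (Finset.union_subset_union_right (by simpa using hz))) hρg (heP z) (heg z)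
        exact congrFun this ⟨z, by simp⟩
      exact hcongr _ _ _ hval (hR _ _ _ Finset.subset_union_right (hρ.self hR hcongr))

end LocalToGlobal

/-- Every set of at most `a` variables lies in the domain of some member of `U`. -/
def Cofinal {X V : Type} (a : ℕ) (U : Set (Finset X × Finset (X → V))) : Prop :=
  ∀ S : Finset X, S.card ≤ a → ∃ p ∈ U, S ⊆ p.1

/-- A set of at most `m` variables forces all lists in `U` to contain a function agreeing with
`ρ` on `F`. -/
def Robust {X V : Type} (U : Set (Finset X × Finset (X → V))) (m : ℕ) (F : Finset X)
    (ρ : X → V) : Prop :=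
  ∃ S : Finset X, S.card ≤ m ∧ ∀ p ∈ U, S ⊆ p.1 → ∃ σ ∈ p.2, ∀ x ∈ F, σ x = ρ x

section Robust

variable {X V : Type} [DecidableEq X] {U W : Set (Finset X × Finset (X → V))}

lemma encard_restrict_robust_le {r m a : ℕ} (hU : Cofinal a U) (hr : ∀ p ∈ U, p.2.card ≤ r)
    (ha : (r + 1) * m ≤ a) (F : Finset X) :
    (F.restrict '' {ρ : X → V | Robust U m F ρ}).encard ≤ r := by
  classical
  by_contra! hlt
  obtain ⟨t, hts, htc⟩ := Set.exists_subset_encard_eq (Order.add_one_le_of_lt hlt)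
  have hfin : t.Finite := Set.finite_of_encard_eq_coe (k := r + 1) (by exact_mod_cast htc)
  have hw : ∀ p : F → V, ∃ S : Finset X, S.card ≤ m ∧
      (p ∈ t → ∀ o ∈ U, S ⊆ o.1 → ∃ σ ∈ o.2, F.restrict σ = p) := by
    intro p
    by_cases hp : p ∈ t
    · obtain ⟨ρ, ⟨S, hS, h⟩, rfl⟩ := hts hp
      refine ⟨S, hS, fun _ o ho hSo => ?_⟩
      obtain ⟨σ, hσ, h'⟩ := h o ho hSo
      exact ⟨σ, hσ, funext fun x => h' x x.2⟩
    · exact ⟨∅, by simp, fun h => absurd h hp⟩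
  choose S hSm hS using hw
  have htcard : hfin.toFinset.card = r + 1 := by
    rw [hfin.encard_eq_coe_toFinset_card] at htc
    exact_mod_cast htc
  obtain ⟨o, ho, hSo⟩ := hU (hfin.toFinset.biUnion S)
    ((Finset.card_biUnion_le_card_mul _ _ m fun p _ => hSm p).trans (by rw [htcard]; exact ha))
  have hsub : hfin.toFinset ⊆ o.2.image F.restrict := by
    intro p hp
    obtain ⟨σ, hσ, h⟩ := hS p (by simpa using hp) o ho
      ((Finset.subset_biUnion_of_mem S hp).trans hSo)
    exact Finset.mem_image.2 ⟨σ, hσ, h⟩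
  have := (Finset.card_le_card hsub).trans (Finset.card_image_le.trans (hr o ho))
  omega

/-- The patterns on `F` offered by one member of `U` colour the members of `W`, and one colour
class is cofinal. -/
lemma exists_cofinal_agreeing {r a b b' : ℕ} (hU : Cofinal a U) (hr : ∀ p ∈ U, p.2.card ≤ r)
    (hW : Cofinal b W)
    (hUW : ∀ p ∈ U, ∀ o ∈ W, ∃ σ ∈ p.2, ∃ τ ∈ o.2, ∀ x ∈ p.1 ∩ o.1, σ x = τ x)
    {F : Finset X} (hF : F.card ≤ a) (hb : F.card + r * b' ≤ b) :
    ∃ ρ : X → V, Cofinal b' {o ∈ W | F ⊆ o.1 ∧ ∃ τ ∈ o.2, ∀ x ∈ F, τ x = ρ x} := by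
  classical
  obtain ⟨p, hp, hFp⟩ := hU F hF
  by_contra! hno
  simp only [Cofinal, not_forall, not_exists] at hno
  choose T hT hTo using hno
  obtain ⟨o, ho, hTsub⟩ := hW (F ∪ p.2.biUnion T)
    ((Finset.card_union_le _ _).trans
      ((Nat.add_le_add_left ((Finset.card_biUnion_le_card_mul _ _ b' fun σ _ => hT σ).trans
        (Nat.mul_le_mul_right b' (hr p hp))) _).trans hb))
  obtain ⟨σ, hσ, τ, hτ, hστ⟩ := hUW p hp o ho
  have hFo : F ⊆ o.1 := Finset.subset_union_left.trans hTsub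
  exact hTo σ o ⟨⟨ho, hFo, τ, hτ, fun x hx =>
    (hστ x (Finset.mem_inter.2 ⟨hFp hx, hFo hx⟩)).symm⟩,
    ((Finset.subset_biUnion_of_mem T hσ).trans Finset.subset_union_right).trans hTsub⟩

end Robust

theorem CSP.exists_satisfies_of_cofinal {X V : Type} [DecidableEq X] (P : CSP X V) (r : ℕ)
    (hr : 1 ≤ r) (q : ℕ) :
    ∀ U W : Set (Finset X × Finset (X → V)),
      Cofinal ((2 * r) ^ (r + 2 * q)) U → Cofinal ((2 * r) ^ (r + 2 * q + 2)) W →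
      (∀ p ∈ U, p.2.card ≤ r ∧ ∀ σ ∈ p.2, P.PartialSat p.1 σ) →
      (∀ o ∈ W, o.2.card ≤ q) →
      (∀ p ∈ U, ∀ o ∈ W, ∃ σ ∈ p.2, ∃ τ ∈ o.2, ∀ x ∈ p.1 ∩ o.1, σ x = τ x) →
      ∃ σ : X → V, P.Satisfies σ := by
  classical
  induction q with
  | zero =>
    intro U W hU hW _ hWq hUW
    obtain ⟨p, hp, -⟩ := hU ∅ (by simp)
    obtain ⟨o, ho, -⟩ := hW ∅ (by simp)
    obtain ⟨-, -, τ, hτ, -⟩ := hUW p hp o ho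
    rw [Finset.card_eq_zero.1 (Nat.le_zero.1 (hWq o ho))] at hτ
    simp at hτ
  | succ q ih =>
    intro U W hU hW hUr hWq hUW
    by_contra hsat
    set a := (2 * r) ^ (r + 2 * q) with ha
    set f := (2 * r) ^ r with hf
    have hfa : f ≤ a := Nat.pow_le_pow_right (by omega) (by omega)
    have hf2 : 2 ≤ f := le_trans (by omega : 2 ≤ 2 * r) (Nat.le_self_pow (by omega) _)
    have hA : (2 * r) ^ (r + 2 * (q + 1)) = 4 * r ^ 2 * a := by rw [ha]; ring
    have hB' : (2 * r) ^ (r + 2 * q + 2) = 4 * r ^ 2 * a := by rw [ha]; ring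
    have hB : (2 * r) ^ (r + 2 * (q + 1) + 2) = 4 * r ^ 2 * (4 * r ^ 2 * a) := by rw [ha]; ring
    rw [hA] at hU
    rw [hB] at hW
    rw [hB'] at ih
    have hrr : r ≤ r ^ 2 := Nat.le_self_pow (by omega) _
    have haA : (r + 1) * (a + f) ≤ 4 * r ^ 2 * a :=
      calc (r + 1) * (a + f) ≤ (2 * r) * (a + a) := Nat.mul_le_mul (by omega) (by omega)
        _ = 4 * r * a := by ring
        _ ≤ 4 * r ^ 2 * a := Nat.mul_le_mul_right _ (by omega)
    have haf : a + f ≤ 4 * r ^ 2 * a := le_trans (Nat.le_mul_of_pos_left _ (by omega)) haA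
    have hex : ∀ F : Finset X, F.card ≤ f → ∃ ρ, Robust U (a + f) F ρ := by
      intro F hF
      obtain ⟨ρ, hρ⟩ := exists_cofinal_agreeing (b' := 4 * r ^ 2 * a) hU
        (fun p hp => (hUr p hp).1) hW hUW (F := F) (by omega) (by
          have h1 : (r + 1) * (4 * r ^ 2 * a) ≤ 4 * r ^ 2 * (4 * r ^ 2 * a) :=
            Nat.mul_le_mul_right _ (by omega)
          rw [add_mul, one_mul] at h1
          omega)
      refine ⟨ρ, ?_⟩
      by_contra hrob
      refine hsat (ih {p ∈ U | F ⊆ p.1 ∧ ¬ ∃ σ ∈ p.2, ∀ x ∈ F, σ x = ρ x}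
        ((fun o : Finset X × Finset (X → V) =>
          (o.1, {τ ∈ o.2 | ¬ ∀ x ∈ F, τ x = ρ x})) ''
          {o ∈ W | F ⊆ o.1 ∧ ∃ τ ∈ o.2, ∀ x ∈ F, τ x = ρ x}) ?_ ?_ ?_ ?_ ?_)
      · intro S hS
        by_contra hS'
        refine hrob ⟨S ∪ F, (Finset.card_union_le _ _).trans (by omega), fun p hp hSp => ?_⟩
        by_contra hσ
        exact hS' ⟨p, ⟨hp, Finset.subset_union_right.trans hSp, hσ⟩,
          Finset.subset_union_left.trans hSp⟩
      · intro T hT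
        obtain ⟨o, ho, hTo⟩ := hρ T hT
        exact ⟨_, ⟨o, ho, rfl⟩, hTo⟩
      · exact fun p hp => hUr p hp.1
      · rintro _ ⟨o, ⟨ho, -, τ, hτ, hτρ⟩, rfl⟩
        have hlt : ({τ ∈ o.2 | ¬ ∀ x ∈ F, τ x = ρ x} : Finset (X → V)).card < o.2.card := by
          apply Finset.card_lt_card
          rw [Finset.filter_ssubset]
          exact ⟨τ, hτ, by simpa using hτρ⟩
        have := hWq o ho
        simp only
        omega
      · rintro p ⟨hp, hFp, hpρ⟩ _ ⟨o, ⟨ho, hFo, -⟩, rfl⟩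
        obtain ⟨σ, hσ, τ, hτ, hστ⟩ := hUW p hp o ho
        refine ⟨σ, hσ, τ, Finset.mem_filter.2 ⟨hτ, fun hτρ => hpρ ⟨σ, hσ, fun x hx => ?_⟩⟩, hστ⟩
        rw [hστ x (Finset.mem_inter.2 ⟨hFp hx, hFo hx⟩), hτρ x hx]
    obtain ⟨ρ₀, -⟩ := hex ∅ (by simp)
    obtain ⟨σ, hσ⟩ := exists_global_of_prolongs (R := Robust U (a + f))
      (fun F F' ρ hFF' ⟨S, hS, h⟩ => ⟨S, hS, fun p hp hSp =>
        (h p hp hSp).imp fun σ hσ => ⟨hσ.1, fun x hx => hσ.2 x (hFF' hx)⟩⟩)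
      (fun F ρ ρ' hρ ⟨S, hS, h⟩ => ⟨S, hS, fun p hp hSp =>
        (h p hp hSp).imp fun σ hσ => ⟨hσ.1, fun x hx => (hσ.2 x hx).trans (hρ x hx)⟩⟩)
      (encard_restrict_robust_le hU (fun p hp => (hUr p hp).1) haA)
      (fun n => if n = 0 then 0 else (2 * r) ^ n)
      (by
        intro n
        rcases Nat.eq_zero_or_pos n with rfl | hn
        · simp; omega
        · have h2 : 2 ≤ (2 * r) ^ n :=
            le_trans (by omega : 2 ≤ 2 * r) (Nat.le_self_pow (by omega) _)
          have h3 : (2 * r) ^ n ≤ r * (2 * r) ^ n := Nat.le_mul_of_pos_left _ (by omega)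
          have h4 : (2 * r) ^ (n + 1) = 2 * (r * (2 * r) ^ n) := by ring
          simp only [if_neg hn.ne', if_neg n.succ_ne_zero]
          omega)
      r Unit (by simp; omega) ∅ (fun _ => ρ₀)
      (fun _ K hK => by
        rw [if_neg (by omega)] at hK
        simpa using hex K hK)
      (Function.injective_of_subsingleton _)
    have hpair : ∀ x y, ∃ p ∈ U, x ∈ p.1 ∧ y ∈ p.1 ∧ ∃ ρ ∈ p.2, ρ x = σ x ∧ ρ y = σ y := by
      intro x y
      obtain ⟨S, hS, h⟩ := hσ x y
      obtain ⟨p, hp, hSp⟩ := hU (S ∪ {x, y}) ((Finset.card_union_le _ _).trans (by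
        have h1 : ({x, y} : Finset X).card ≤ 2 := Finset.card_le_two
        have h2 : 4 * a ≤ 4 * r ^ 2 * a := Nat.mul_le_mul_right _ (by omega)
        omega))
      obtain ⟨ρ, hρ, hρσ⟩ := h p hp (Finset.subset_union_left.trans hSp)
      exact ⟨p, hp, hSp (by simp), hSp (by simp), ρ, hρ, hρσ x (by simp), hρσ y (by simp)⟩
    refine hsat ⟨σ, fun x => ?_, fun c hc => ?_⟩
    · obtain ⟨p, hp, hx, -, ρ, hρ, hρx, -⟩ := hpair x x
      rw [← hρx]
      exact ((hUr p hp).2 ρ hρ).1 x hx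
    · obtain ⟨p, hp, hx, hy, ρ, hρ, hρx, hρy⟩ := hpair c.1.1 c.1.2
      rw [← hρx, ← hρy]
      exact ((hUr p hp).2 ρ hρ).2 c hc hx hy

/-- final bipartite lemma: with `a = (2r)^(r+2q)` and
`b = (2r)^(r+2q+2)`, if an `r`-sized multi-assignment `u` on `a`-subsets and a
`q`-sized multi-assignment `v` on `b`-subsets (all values being partial
satisfying assignments) list-satisfy every bipartite consistency constraint,
then `Π` has a globally satisfying assignment. -/
theorem final_bipartite_lemma {X V : Type} [Fintype X] [DecidableEq X]
    (P : CSP X V) (r q : ℕ) (hr : 1 ≤ r) (hq : 1 ≤ q)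
    (a b : ℕ) (hadef : a = (2 * r) ^ (r + 2 * q)) (hbdef : b = (2 * r) ^ (r + 2 * q + 2))
    (hX : 2 * b ≤ Fintype.card X)
    (u : Finset X → Set (X → V))
    (hu : ∀ S : Finset X, S.card = a →
      (u S).Finite ∧ (u S).Nonempty ∧ (u S).ncard ≤ r ∧ ∀ σ ∈ u S, P.PartialSat S σ)
    (v : Finset X → Set (X → V))
    (hv : ∀ T : Finset X, T.card = b →
      (v T).Finite ∧ (v T).Nonempty ∧ (v T).ncard ≤ q ∧ ∀ τ ∈ v T, P.PartialSat T τ)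
    (hcons : ∀ S T : Finset X, S.card = a → T.card = b →
      ∃ σ ∈ u S, ∃ τ ∈ v T, ∀ x ∈ S ∩ T, σ x = τ x) :
    ∃ σ : X → V, P.Satisfies σ := by
  classical
  subst hadef hbdef
  have hab : (2 * r) ^ (r + 2 * q) ≤ (2 * r) ^ (r + 2 * q + 2) :=
    Nat.pow_le_pow_right (by omega) (by omega)
  have hcof : ∀ (c : ℕ) (w : Finset X → Set (X → V)), (∀ S, S.card = c → (w S).Finite) →
      c ≤ Fintype.card X →
      Cofinal c {p : Finset X × Finset (X → V) | p.1.card = c ∧ (p.2 : Set (X → V)) = w p.1} := by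
    intro c w hw hc S hS
    obtain ⟨T, hST, hT⟩ := Finset.exists_superset_card_eq hS hc
    exact ⟨(T, (hw T hT).toFinset), ⟨hT, by simp⟩, hST⟩
  refine P.exists_satisfies_of_cofinal r hr q _ _
    (hcof _ u (fun S hS => (hu S hS).1) (by omega)) (hcof _ v (fun T hT => (hv T hT).1) (by omega))
    ?_ ?_ ?_
  · rintro ⟨S, L⟩ ⟨hS, hL⟩
    obtain ⟨-, -, h1, h2⟩ := hu S hS
    simp only at hL
    rw [← hL] at h1 h2
    exact ⟨by simpa using h1, fun σ hσ => h2 σ hσ⟩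
  · rintro ⟨T, M⟩ ⟨hT, hM⟩
    obtain ⟨-, -, h1, -⟩ := hv T hT
    simp only at hM
    rw [← hM] at h1
    simpa using h1
  · rintro ⟨S, L⟩ ⟨hS, hL⟩ ⟨T, M⟩ ⟨hT, hM⟩
    obtain ⟨σ, hσ, τ, hτ, h⟩ := hcons S T hS hT
    simp only at hL hM
    rw [← hL] at hσ
    rw [← hM] at hτ
    exact ⟨σ, hσ, τ, hτ, h⟩
end

section
/- (Main theorem, soundness.) For every integer r ≥ 1 there exists an integer t (one may take t = (2r)^{3r+2}) such that for every 2CSP instance Π = (X, Σ, Φ) with |X| sufficiently large: if the t-wise direct product Π^⊙t admits an r-list satisfying multi-assignment, then Π is satisfiable. -/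
section Branching

open Finset

variable {X V : Type}

/-- `g` extends, from `C`, to a member of `T` on every enlargement of `C` by at most `s` points. -/
def Survives [DecidableEq X] (T : Finset X → (X → V) → Prop) (s : ℕ) (C : Finset X) (g : X → V) : Prop :=
  ∀ D : Finset X, #D ≤ s → ∃ g', T (C ∪ D) g' ∧ Set.EqOn g' g C

/-- A finite set of functions that are pairwise distinct on `C`. -/
def DistinctOn (C : Finset X) (F : Finset (X → V)) : Prop :=
  ∀ f ∈ F, ∀ g ∈ F, Set.EqOn f g C → f = g

/-- The number of points by which survivors must extend so that they can branch `j` times. -/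
def branchDepth (r : ℕ) : ℕ → ℕ
  | 0 => 0
  | j + 1 => 2 + r * branchDepth r j

/-- A predicate on partial assignments of at most `c` variables that is closed under restriction,
nonempty on each domain, and has at most `r` members on each domain. -/
structure BoundedPresheaf (T : Finset X → (X → V) → Prop) (r c : ℕ) : Prop where
  restrict : ∀ C C' g, C ⊆ C' → T C' g → T C g
  nonempty : ∀ C, #C ≤ c → ∃ g, T C g
  bounded : ∀ C F, #C ≤ c → (∀ g ∈ F, T C g) → DistinctOn C F → #F ≤ r

namespace BoundedPresheaf

variable {T : Finset X → (X → V) → Prop} {r c : ℕ}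

theorem one_le (hT : BoundedPresheaf T r c) : 1 ≤ r := by
  obtain ⟨g, hg⟩ := hT.nonempty ∅ (by simp)
  simpa using hT.bounded ∅ {g} (by simp) (by simpa using hg) (by simp [DistinctOn])

theorem exists_representatives (hT : BoundedPresheaf T r c) {C : Finset X} (hC : #C ≤ c) :
    ∃ F : Finset (X → V), #F ≤ r ∧ ∀ g, T C g → ∃ f ∈ F, Set.EqOn f g C := by
  classical
  by_contra! hno
  have key : ∀ k, ∃ F : Finset (X → V), #F = k ∧ (∀ g ∈ F, T C g) ∧ DistinctOn C F := by
    intro k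
    induction k with
    | zero => exact ⟨∅, by simp [DistinctOn]⟩
    | succ k ih =>
      obtain ⟨F, hk, hF, hd⟩ := ih
      obtain ⟨g, hg, hgF⟩ := hno F (hT.bounded C F hC hF hd)
      have hmem : g ∉ F := fun h => hgF g h (Set.eqOn_refl _ _)
      refine ⟨insert g F, by rw [card_insert_of_notMem hmem, hk], ?_, ?_⟩
      · intro f hf
        rcases mem_insert.1 hf with rfl | hf
        exacts [hg, hF f hf]
      · intro f hf f' hf' he
        rcases mem_insert.1 hf with hfg | hf <;> rcases mem_insert.1 hf' with hfg' | hf'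
        · rw [hfg, hfg']
        · exact (hgF f' hf' (hfg ▸ he.symm)).elim
        · exact (hgF f hf (hfg' ▸ he)).elim
        · exact hd f hf f' hf' he
  obtain ⟨F, hk, hF, hd⟩ := key (r + 1)
  have := hT.bounded C F hC hF hd
  omega

variable [DecidableEq X]

theorem survives_restrict (hT : BoundedPresheaf T r c) {s : ℕ} {C C' : Finset X} {g : X → V}
    (h : C ⊆ C') (hg : Survives T s C' g) : Survives T s C g := by
  intro D hD
  obtain ⟨g', hg', he⟩ := hg D hD
  exact ⟨g', hT.restrict _ _ _ (union_subset_union_left h) hg', he.mono (by exact_mod_cast h)⟩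

theorem exists_survives_extension (hT : BoundedPresheaf T r c) {s s' : ℕ} {C D : Finset X}
    {g : X → V} (hg : Survives T s C g) (hs : #D + r * s' ≤ s) (hC : #(C ∪ D) ≤ c) :
    ∃ g', Survives T s' (C ∪ D) g' ∧ Set.EqOn g' g C := by
  classical
  obtain ⟨F, hFr, hF⟩ := hT.exists_representatives hC
  by_contra! hno
  have hdead : ∀ f : X → V, ∃ E : Finset X, #E ≤ s' ∧ (Set.EqOn f g C →
      ∀ g', T (C ∪ D ∪ E) g' → ¬ Set.EqOn g' f ↑(C ∪ D)) := by
    intro f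
    by_cases hf : Set.EqOn f g C
    · have : ¬ Survives T s' (C ∪ D) f := fun h => hno f h hf
      unfold Survives at this
      push Not at this
      obtain ⟨E, hE, h⟩ := this
      exact ⟨E, hE, fun _ => h⟩
    · exact ⟨∅, by simp, fun h => (hf h).elim⟩
  choose E hE hdead using hdead
  have hcard : #(D ∪ F.biUnion E) ≤ s := by
    have h1 := card_union_le D (F.biUnion E)
    have h2 := card_biUnion_le_card_mul F E s' (fun f _ => hE f)
    have h3 := Nat.mul_le_mul_right s' hFr
    omega
  obtain ⟨g', hg', he⟩ := hg _ hcard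
  obtain ⟨f, hf, hfe⟩ := hF g' (hT.restrict _ _ _ (by grind) hg')
  refine hdead f ?_ g' (hT.restrict _ _ _ ?_ hg') hfe.symm
  · exact (hfe.mono (by simp)).trans he
  · have := subset_biUnion_of_mem E hf
    grind

/-- The survivors either extend uniquely, and then glue, or branch. -/
theorem exists_glued_of_survives (hT : BoundedPresheaf T r c) (j : ℕ) :
    ∀ (C : Finset X) (F : Finset (X → V)), #C + branchDepth r j ≤ c → F.Nonempty →
      (∀ g ∈ F, Survives T (branchDepth r j) C g) → DistinctOn C F → r + 1 ≤ #F + j →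
      ∃ σ : X → V, ∀ x y, ∃ g, T {x, y} g ∧ g x = σ x ∧ g y = σ y := by
  classical
  induction j with
  | zero =>
    intro C F hC _ hF hd hcard
    have hsurv : ∀ g : X → V, ∃ g', g ∈ F → T C g' ∧ Set.EqOn g' g C := by
      intro g
      by_cases hg : g ∈ F
      · obtain ⟨g', h⟩ := hF g hg ∅ (by simp)
        exact ⟨g', fun _ => by simpa using h⟩
      · exact ⟨g, fun h => (hg h).elim⟩
    choose e he using hsurv
    have hinj : Set.InjOn e F := fun f hf g hg hfg =>
      hd f hf g hg ((he f hf).2.symm.trans (hfg ▸ (he g hg).2))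
    have := hT.bounded C (F.image e) (by omega)
      (by
        intro g hg
        obtain ⟨f, hf, rfl⟩ := mem_image.1 hg
        exact (he f hf).1)
      (by
        intro a ha b hb hab
        obtain ⟨f, hf, rfl⟩ := mem_image.1 ha
        obtain ⟨g, hg, rfl⟩ := mem_image.1 hb
        rw [hd f hf g hg ((he f hf).2.symm.trans (hab.trans (he g hg).2))])
    rw [card_image_of_injOn hinj] at this
    omega
  | succ j ih =>
    intro C F hC hne hF hd hcard
    obtain ⟨g₀, hg₀⟩ := hne
    simp only [branchDepth] at hC hF
    have hext : ∀ g ∈ F, ∀ D : Finset X, #D ≤ 2 →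
        ∃ g', Survives T (branchDepth r j) (C ∪ D) g' ∧ Set.EqOn g' g C := by
      intro g hg D hD
      have := card_union_le C D
      have := Nat.zero_le (r * branchDepth r j)
      exact hT.exists_survives_extension (hF g hg) (by omega) (by omega)
    by_cases huniq : ∀ x g₁ g₂, Survives T (branchDepth r j) (C ∪ {x}) g₁ → Set.EqOn g₁ g₀ C →
        Survives T (branchDepth r j) (C ∪ {x}) g₂ → Set.EqOn g₂ g₀ C → g₁ x = g₂ x
    · choose e he using fun x : X => hext g₀ hg₀ {x} (by simp)
      refine ⟨fun x => e x x, fun x y => ?_⟩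
      obtain ⟨g, hg, hgC⟩ := hext g₀ hg₀ {x, y} card_le_two
      obtain ⟨g', hg', hgg⟩ := hg ∅ (by simp)
      refine ⟨g', hT.restrict _ _ _ (by grind) hg', ?_, ?_⟩
      · rw [hgg (by simp)]
        exact huniq x _ _ (hT.survives_restrict (by grind) hg) hgC (he x).1 (he x).2
      · rw [hgg (by simp)]
        exact huniq y _ _ (hT.survives_restrict (by grind) hg) hgC (he y).1 (he y).2
    · push Not at huniq
      obtain ⟨x, g₁, g₂, h₁, h₁C, h₂, h₂C, hne⟩ := huniq
      have hsurv : ∀ g : X → V, ∃ g', g ∈ F →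
          (Survives T (branchDepth r j) (C ∪ {x}) g' ∧ Set.EqOn g' g C) ∧ (g = g₀ → g' = g₁) := by
        intro g
        by_cases hg₀' : g = g₀
        · exact ⟨g₁, fun _ => ⟨⟨h₁, hg₀' ▸ h₁C⟩, fun _ => rfl⟩⟩
        by_cases hg : g ∈ F
        · obtain ⟨g', h⟩ := hext g hg {x} (by simp)
          exact ⟨g', fun _ => ⟨h, fun h => (hg₀' h).elim⟩⟩
        · exact ⟨g, fun h => (hg h).elim⟩
      choose e he using hsurv
      have hinj : Set.InjOn e F := fun f hf g hg hfg =>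
        hd f hf g hg ((he f hf).1.2.symm.trans (hfg ▸ (he g hg).1.2))
      have hsub : (C : Set X) ⊆ ↑(C ∪ {x}) := by simp
      have hbranch : ∀ f ∈ F, ¬ Set.EqOn (e f) g₂ ↑(C ∪ {x}) := by
        intro f hf heq
        have : f = g₀ := hd f hf g₀ hg₀
          ((he f hf).1.2.symm.trans ((heq.mono hsub).trans h₂C))
        exact hne ((he f hf).2 this ▸ heq (by simp))
      have hmem : g₂ ∉ F.image e := by
        intro h
        obtain ⟨f, hf, hfe⟩ := mem_image.1 h
        exact hbranch f hf (hfe ▸ Set.eqOn_refl _ _)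
      refine ih (C ∪ {x}) (insert g₂ (F.image e)) ?_ (insert_nonempty _ _) ?_ ?_ ?_
      · have := card_union_le C {x}
        rw [card_singleton] at this
        have := Nat.le_mul_of_pos_left (branchDepth r j) hT.one_le
        omega
      · intro g hg
        rcases mem_insert.1 hg with rfl | hg
        · exact h₂
        · obtain ⟨f, hf, rfl⟩ := mem_image.1 hg
          exact (he f hf).1.1
      · intro a ha b hb hab
        rcases mem_insert.1 ha with hag | ha <;> rcases mem_insert.1 hb with hbg | hb
        · rw [hag, hbg]
        · obtain ⟨f, hf, rfl⟩ := mem_image.1 hb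
          exact (hbranch f hf (hag ▸ hab.symm)).elim
        · obtain ⟨f, hf, rfl⟩ := mem_image.1 ha
          exact (hbranch f hf (hbg ▸ hab)).elim
        · obtain ⟨f, hf, rfl⟩ := mem_image.1 ha
          obtain ⟨g, hg, rfl⟩ := mem_image.1 hb
          rw [hd f hf g hg ((he f hf).1.2.symm.trans ((hab.mono hsub).trans (he g hg).1.2))]
      · rw [card_insert_of_notMem hmem, card_image_of_injOn hinj]
        omega

theorem exists_glued (hT : BoundedPresheaf T r (branchDepth r r)) :
    ∃ σ : X → V, ∀ x y, ∃ g, T {x, y} g ∧ g x = σ x ∧ g y = σ y := by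
  obtain ⟨g, -⟩ := hT.nonempty ∅ (by simp)
  refine hT.exists_glued_of_survives r ∅ {g} (by simp) (by simp) ?_ ?_ (by simp [add_comm])
  · intro g _ D hD
    obtain ⟨g', hg'⟩ := hT.nonempty (∅ ∪ D) (by simpa using hD)
    exact ⟨g', hg', by simp⟩
  · intro f hf f' hf' _
    rw [mem_singleton.1 hf, mem_singleton.1 hf']

end BoundedPresheaf

end Branching

section ListSystem

open Finset

variable {X V : Type}

theorem CSP.PartialSat.mono {P : CSP X V} {S S' : Finset X} {σ : X → V} (h : P.PartialSat S' σ)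
    (hS : S ⊆ S') : P.PartialSat S σ :=
  ⟨fun x hx => h.1 x (hS hx), fun c hc h₁ h₂ => h.2 c hc (hS h₁) (hS h₂)⟩

variable [DecidableEq X]

/-- Lists of at most `p`, respectively `q`, assignments on all sets of at most `n` variables such
that each left list has a member agreeing with a member of each right list. -/
structure ListSystem (P : CSP X V) (n p q : ℕ) (L R : Finset X → Finset (X → V)) : Prop where
  card_left : ∀ A, #A ≤ n → #(L A) ≤ p
  card_right : ∀ B, #B ≤ n → #(R B) ≤ q
  partialSat : ∀ A, #A ≤ n → ∀ f ∈ L A, P.PartialSat A f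
  consistent : ∀ A B, #A ≤ n → #B ≤ n → ∃ f ∈ L A, ∃ g ∈ R B, ∀ x ∈ A ∩ B, f x = g x

/-- Every set of at most `m` variables lies in a set of at most `n` variables whose list
contains an extension of `g` restricted to `C`. -/
def Recurrent (M : Finset X → Finset (X → V)) (m n : ℕ) (C : Finset X) (g : X → V) : Prop :=
  ∀ A : Finset X, #A ≤ m → ∃ A', A ∪ C ⊆ A' ∧ #A' ≤ n ∧ ∃ f ∈ M A', Set.EqOn f g C

/-- Beyond some set of at most `m` variables, all lists contain an extension of `g` restricted
to `C`. -/
def Unavoidable (M : Finset X → Finset (X → V)) (m n : ℕ) (C : Finset X) (g : X → V) : Prop :=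
  ∃ B : Finset X, #B ≤ m ∧ ∀ B', B ∪ C ⊆ B' → #B' ≤ n → ∃ f ∈ M B', Set.EqOn f g C

namespace ListSystem

variable {P : CSP X V} {n p q : ℕ} {L R : Finset X → Finset (X → V)}

/-- Deleting from the left lists an assignment that the right lists can avoid. -/
theorem exists_shrink (h : ListSystem P n (p + 1) q L R) {m : ℕ} {C : Finset X} {g : X → V}
    (hL : Recurrent L m n C g) (hR : ¬ Unavoidable R m n C g) :
    ∃ L' R', ListSystem P m p q L' R' := by
  classical
  have hL' : ∀ A : Finset X, ∃ A', #A ≤ m →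
      A ∪ C ⊆ A' ∧ #A' ≤ n ∧ ∃ f ∈ L A', Set.EqOn f g C := by
    intro A
    by_cases hA : #A ≤ m
    · obtain ⟨A', h⟩ := hL A hA
      exact ⟨A', fun _ => h⟩
    · exact ⟨∅, fun h => (hA h).elim⟩
  have hR' : ∀ B : Finset X, ∃ B', #B ≤ m →
      B ∪ C ⊆ B' ∧ #B' ≤ n ∧ ∀ f ∈ R B', ¬ Set.EqOn f g C := by
    intro B
    by_cases hB : #B ≤ m
    · unfold Unavoidable at hR
      push Not at hR
      obtain ⟨B', h⟩ := hR B hB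
      exact ⟨B', fun _ => h⟩
    · exact ⟨∅, fun h => (hB h).elim⟩
  choose a ha using hL'
  choose b hb using hR'
  refine ⟨fun A => {f ∈ L (a A) | ¬ Set.EqOn f g C}, fun B => R (b B), ?_, ?_, ?_, ?_⟩
  · intro A hA
    obtain ⟨-, hcard, f, hf, hfg⟩ := ha A hA
    have : #{f ∈ L (a A) | ¬ Set.EqOn f g C} < #(L (a A)) :=
      card_lt_card (filter_ssubset.2 ⟨f, hf, not_not.2 hfg⟩)
    have := h.card_left _ hcard
    omega
  · exact fun B hB => h.card_right _ (hb B hB).2.1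
  · intro A hA f hf
    exact (h.partialSat _ (ha A hA).2.1 f (mem_filter.1 hf).1).mono
      (subset_union_left.trans (ha A hA).1)
  · intro A B hA hB
    obtain ⟨hAs, hAn, -⟩ := ha A hA
    obtain ⟨hBs, hBn, hav⟩ := hb B hB
    obtain ⟨f, hf, f', hf', he⟩ := h.consistent _ _ hAn hBn
    refine ⟨f, mem_filter.2 ⟨hf, fun hfg => hav f' hf' ?_⟩, f', hf', fun x hx => he x (by grind)⟩
    intro x hx
    have hx : x ∈ C := hx
    rw [← he x (by grind), hfg hx]

theorem boundedPresheaf_recurrent {r m c : ℕ} (h : ListSystem P n p q L R) (hq : q ≤ r)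
    (hn : (r + 1) * m + c ≤ n)
    (hun : ∀ C g, Recurrent L m n C g → Unavoidable R m n C g) :
    BoundedPresheaf (Recurrent L m n) r c := by
  classical
  refine ⟨?_, ?_, ?_⟩
  · intro C C' g hCC hg A hA
    obtain ⟨A', hA', hcard, f, hf, he⟩ := hg A hA
    exact ⟨A', (union_subset_union_right hCC).trans hA', hcard, f, hf,
      he.mono (by exact_mod_cast hCC)⟩
  · intro C hC
    by_contra! hno
    have hkill : ∀ g : X → V, ∃ A : Finset X, #A ≤ m ∧ ∀ A', A ∪ C ⊆ A' → #A' ≤ n →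
        ∀ f ∈ L A', ¬ Set.EqOn f g C := by
      intro g
      have := hno g
      unfold Recurrent at this
      push Not at this
      exact this
    choose A hA hkill using hkill
    have hCn : #C ≤ n := by
      have := Nat.zero_le ((r + 1) * m)
      omega
    have hcard : #((R C).biUnion A ∪ C) ≤ n := by
      have h1 := card_union_le ((R C).biUnion A) C
      have h2 := card_biUnion_le_card_mul (R C) A m (fun g _ => hA g)
      have h3 := Nat.mul_le_mul_right m (show #(R C) ≤ r + 1 by
        have := h.card_right C hCn
        omega)
      omega
    obtain ⟨f, hf, g, hg, he⟩ := h.consistent _ C hcard hCn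
    refine hkill g _ (union_subset_union_left (subset_biUnion_of_mem A hg)) hcard f hf ?_
    intro x hx
    have hx : x ∈ C := hx
    exact he x (by simp [hx])
  · intro C F hC hF hd
    by_contra! hr
    obtain ⟨F', hF', hcardF⟩ := exists_subset_card_eq (Nat.succ_le_of_lt hr)
    have hB : ∀ g : X → V, ∃ B : Finset X, #B ≤ m ∧ (g ∈ F → ∀ B', B ∪ C ⊆ B' → #B' ≤ n →
        ∃ f ∈ R B', Set.EqOn f g C) := by
      intro g
      by_cases hg : g ∈ F
      · obtain ⟨B, hB, hB'⟩ := hun C g (hF g hg)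
        exact ⟨B, hB, fun _ => hB'⟩
      · exact ⟨∅, by simp, fun h => (hg h).elim⟩
    choose B hB hB' using hB
    have hcard : #(F'.biUnion B ∪ C) ≤ n := by
      have h1 := card_union_le (F'.biUnion B) C
      have h2 := card_biUnion_le_card_mul F' B m (fun g _ => hB g)
      rw [hcardF] at h2
      simp only [Nat.succ_eq_add_one] at h2
      omega
    have hle : #F' ≤ #(R (F'.biUnion B ∪ C)) := by
      refine card_le_card_of_forall_subsingleton (fun g f => Set.EqOn f g C) ?_ ?_
      · intro g hg
        exact hB' g (hF' hg) _ (union_subset_union_left (subset_biUnion_of_mem B hg)) hcard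
      · intro f _ g hg g' hg'
        exact hd g (hF' hg.1) g' (hF' hg'.1) (hg.2.symm.trans hg'.2)
    have := h.card_right _ hcard
    omega

end ListSystem

/-- The set sizes on which left lists of length `k` force satisfiability. -/
def levelSize (r : ℕ) : ℕ → ℕ
  | 0 => 0
  | k + 1 => (r + 1) * levelSize r k + branchDepth r r

theorem ListSystem.exists_satisfies {P : CSP X V} {r q : ℕ} (hq : q ≤ r) (p : ℕ) :
    ∀ L R, ListSystem P (levelSize r p) p q L R → ∃ σ, P.Satisfies σ := by
  induction p with
  | zero =>
    intro L R h
    obtain ⟨f, hf, -⟩ := h.consistent ∅ ∅ (by simp) (by simp)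
    have := card_pos.2 ⟨f, hf⟩
    have := h.card_left ∅ (by simp)
    omega
  | succ p ih =>
    intro L R h
    by_cases hun : ∀ C g, Recurrent L (levelSize r p) (levelSize r (p + 1)) C g →
        Unavoidable R (levelSize r p) (levelSize r (p + 1)) C g
    · obtain ⟨σ, hσ⟩ := (h.boundedPresheaf_recurrent hq le_rfl hun).exists_glued
      have hsat : ∀ x y, ∃ f, P.PartialSat {x, y} f ∧ f x = σ x ∧ f y = σ y := by
        intro x y
        obtain ⟨g, hg, hx, hy⟩ := hσ x y
        obtain ⟨A, hA, hcard, f, hf, he⟩ := hg ∅ (by simp)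
        exact ⟨f, (h.partialSat A hcard f hf).mono (subset_union_right.trans hA),
          by rw [he (by simp), hx], by rw [he (by simp), hy]⟩
      refine ⟨σ, fun x => ?_, fun c hc => ?_⟩
      · obtain ⟨f, hf, hx, -⟩ := hsat x x
        exact hx ▸ hf.1 x (by simp)
      · obtain ⟨f, hf, hx, hy⟩ := hsat c.1.1 c.1.2
        exact hx ▸ hy ▸ hf.2 c hc (by simp) (by simp)
    · push Not at hun
      obtain ⟨C, g, hL, hR⟩ := hun
      obtain ⟨L', R', h'⟩ := h.exists_shrink hL hR
      exact ih L' R' h'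

end ListSystem

theorem branchDepth_add_two_le {r : ℕ} (hr : 1 ≤ r) (j : ℕ) :
    branchDepth r j + 2 ≤ 2 * (2 * r) ^ j := by
  induction j with
  | zero => simp [branchDepth]
  | succ j ih =>
    have := Nat.mul_le_mul_left (2 * r) ih
    rw [branchDepth, pow_succ]
    nlinarith [Nat.zero_le (r * branchDepth r j)]

theorem levelSize_add_le {r : ℕ} (hr : 1 ≤ r) (k : ℕ) :
    levelSize r k + branchDepth r r ≤ branchDepth r r * (2 * r) ^ k := by
  induction k with
  | zero => simp [levelSize]
  | succ k ih =>
    have := Nat.mul_le_mul_left (2 * r) ih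
    rw [levelSize, pow_succ]
    nlinarith [Nat.mul_le_mul_right (levelSize r k) hr, Nat.mul_le_mul_right (branchDepth r r) hr]

theorem levelSize_self_le {r : ℕ} (hr : 1 ≤ r) : levelSize r r ≤ (2 * r) ^ (3 * r + 2) := by
  have h₁ := levelSize_add_le hr r
  have h₂ : branchDepth r r ≤ (2 * r) ^ (r + 1) := by
    have := branchDepth_add_two_le hr r
    have := Nat.mul_le_mul_right ((2 * r) ^ r) (show 2 ≤ 2 * r by omega)
    rw [pow_succ']
    omega
  calc levelSize r r ≤ branchDepth r r * (2 * r) ^ r := by omega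
    _ ≤ (2 * r) ^ (r + 1) * (2 * r) ^ r := Nat.mul_le_mul_right _ h₂
    _ = (2 * r) ^ (r + 1 + r) := (pow_add _ _ _).symm
    _ ≤ (2 * r) ^ (3 * r + 2) := Nat.pow_le_pow_right (by omega) (by omega)

/-- main theorem, soundness: for every `r ≥ 1` there is a `t`
(and a largeness threshold `N` on the number of variables) such that whenever the
`t`-wise direct product `Π^⊙t` admits an `r`-list satisfying multi-assignment,
the instance `Π` itself is satisfiable. One may take `t = (2r)^(3r+2)`. -/
theorem baby_pih_soundness (r : ℕ) (hr : 1 ≤ r) :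
    ∃ t N : ℕ, 0 < t ∧ t = (2 * r) ^ (3 * r + 2) ∧
      ∀ (X V : Type) [Fintype X] [DecidableEq X] (P : CSP X V),
        N ≤ Fintype.card X →
        (∃ L : Finset X → Set (X → V),
          (∀ S : Finset X, S.card = t →
            (L S).Finite ∧ (L S).Nonempty ∧ (L S).ncard ≤ r ∧
              ∀ σ ∈ L S, P.PartialSat S σ) ∧
          (∀ S T : Finset X, S.card = t → T.card = t →
            ∃ σ ∈ L S, ∃ τ ∈ L T, ∀ x ∈ S ∩ T, σ x = τ x)) →
        ∃ σ : X → V, P.Satisfies σ := by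
    classical
  refine ⟨(2 * r) ^ (3 * r + 2), (2 * r) ^ (3 * r + 2), by positivity, rfl, ?_⟩
  intro X V _ _ P hN ⟨L, hL, hcons⟩
  have hsup : ∀ A : Finset X, ∃ S : Finset X, A.card ≤ (2 * r) ^ (3 * r + 2) →
      A ⊆ S ∧ S.card = (2 * r) ^ (3 * r + 2) := by
    intro A
    by_cases hA : A.card ≤ (2 * r) ^ (3 * r + 2)
    · obtain ⟨S, hS⟩ := Finset.exists_superset_card_eq hA hN
      exact ⟨S, fun _ => hS⟩
    · exact ⟨∅, fun h => (hA h).elim⟩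
  choose S hS using hsup
  have hle := levelSize_self_le hr
  have hS' : ∀ A, A.card ≤ levelSize r r → A ⊆ S A ∧ (S A).card = (2 * r) ^ (3 * r + 2) :=
    fun A hA => hS A (hA.trans hle)
  let M : Finset X → Finset (X → V) :=
    fun A => if h : (L (S A)).Finite then h.toFinset else ∅
  have hM : ∀ A, A.card ≤ levelSize r r → ∀ f, f ∈ M A ↔ f ∈ L (S A) := by
    intro A hA f
    simp [M, (hL _ (hS' A hA).2).1]
  have hMcard : ∀ A, A.card ≤ levelSize r r → (M A).card ≤ r := by
    intro A hA
    obtain ⟨hfin, -, hcard, -⟩ := hL _ (hS' A hA).2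
    rw [Set.ncard_eq_toFinset_card _ hfin] at hcard
    simpa [M, hfin] using hcard
  refine ListSystem.exists_satisfies (le_refl r) r M M ⟨hMcard, hMcard, ?_, ?_⟩
  · intro A hA f hf
    exact ((hL _ (hS' A hA).2).2.2.2 f ((hM A hA f).1 hf)).mono (hS' A hA).1
  · intro A B hA hB
    obtain ⟨f, hf, g, hg, he⟩ := hcons _ _ (hS' A hA).2 (hS' B hB).2
    exact ⟨f, (hM A hA f).2 hf, g, (hM B hB g).2 hg,
      fun x hx => he x (Finset.inter_subset_inter (hS' A hA).1 (hS' B hB).1 hx)⟩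
end
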